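/- arXiv:1411.0347 — 2 statements merged into one kernel-verified Lean document; each statement's English description precedes it below -/
import Mathlib

section
/- Let C ⊆ ℝ^d be convex, A ∈ ℝ^{n×d}, y ∈ ℝⁿ, and let x_LS ∈ C minimize x ↦ (1/(2n))‖A x − y‖₂² over C. Given any x^t ∈ ℝ^d and any S ∈ ℝ^{m×n}, let x^{t+1} ∈ C minimize x ↦ (1/(2m))‖S A(x − x^t)‖₂² − ⟨Aᵀ(y − A x^t), x⟩ over C. Then Δ = x^{t+1} − x_LS satisfies (1/m)‖S A Δ‖₂² ≤ |⟨A(x_LS − x^t), (Iₙ − (Sᵀ S)/m) A Δ⟩|. -/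
open MeasureTheory Matrix Finset

/-- Squared Euclidean norm of a vector. -/
noncomputable def sqNorm {k : ℕ} (v : Fin k → ℝ) : ℝ := ∑ i, (v i) ^ 2

/-- Euclidean (ℓ₂) norm of a vector. -/
noncomputable def l2norm {k : ℕ} (v : Fin k → ℝ) : ℝ := Real.sqrt (sqNorm v)

/-- Prediction semi-norm ‖v‖_A = (1/√n)‖A v‖₂. -/
noncomputable def predNorm {n d : ℕ} (A : Matrix (Fin n) (Fin d) ℝ) (v : Fin d → ℝ) : ℝ :=
  l2norm (A.mulVec v) / Real.sqrt n

/-- Transformed tangent cone K_LS = {t · A(x − x_LS) : t ≥ 0, x ∈ C}. -/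
def Kcone {n d : ℕ} (A : Matrix (Fin n) (Fin d) ℝ) (C : Set (Fin d → ℝ))
    (xLS : Fin d → ℝ) : Set (Fin n → ℝ) :=
  {v | ∃ t : ℝ, 0 ≤ t ∧ ∃ x ∈ C, v = t • A.mulVec (x - xLS)}

/-- Z₁(S) = inf over unit-norm vectors of the cone of (1/m)‖S v‖₂². -/
noncomputable def Z1 {n m : ℕ} (S : Matrix (Fin m) (Fin n) ℝ) (K : Set (Fin n → ℝ)) : ℝ :=
  sInf ((fun v => (1 / (m : ℝ)) * sqNorm (S.mulVec v)) '' {v ∈ K | l2norm v = 1})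

/-- Z₂(S) = sup over unit-norm vectors of the cone of |⟨u, (SᵀS/m − I) v⟩|. -/
noncomputable def Z2 {n m : ℕ} (S : Matrix (Fin m) (Fin n) ℝ) (K : Set (Fin n → ℝ))
    (u : Fin n → ℝ) : ℝ :=
  sSup ((fun v => |u ⬝ᵥ (((1 / (m : ℝ)) • (Sᵀ * S) - 1).mulVec v)|) '' {v ∈ K | l2norm v = 1})

lemma aux_first_order (b c : ℝ) (h : ∀ t : ℝ, 0 < t → t ≤ 1 → 0 ≤ t * b + t ^ 2 * c) : 0 ≤ b := by
  by_contra hb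
  push Not at hb
  have hp : 0 < |c| - b := by have := abs_nonneg c; linarith
  have hd : 0 < 2 * (|c| - b) := by linarith
  have hc := abs_nonneg c
  have h1 := h (-b / (2 * (|c| - b))) (div_pos (by linarith) hd)
    (by rw [div_le_one hd]; linarith)
  set t := -b / (2 * (|c| - b)) with ht
  have htp : 0 < t := div_pos (by linarith) hd
  have h2 : t * (2 * (|c| - b)) = -b := by rw [ht]; field_simp
  have h3 : 0 ≤ b + t * c := by
    have : 0 ≤ t * (b + t * c) := by nlinarith
    exact nonneg_of_mul_nonneg_right this htp
  have h4 : t * c ≤ t * |c| := mul_le_mul_of_nonneg_left (le_abs_self c) htp.le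
  nlinarith

lemma aux_sqNorm_add {k : ℕ} (v w : Fin k → ℝ) (t : ℝ) :
    sqNorm (v + t • w) = sqNorm v + 2 * t * (v ⬝ᵥ w) + t ^ 2 * sqNorm w := by
  simp only [sqNorm, dotProduct, Finset.mul_sum, ← Finset.sum_add_distrib]
  refine Finset.sum_congr rfl fun i _ => ?_
  simp only [Pi.add_apply, Pi.smul_apply, smul_eq_mul]
  ring

/-- per-step basic inequality for the iterative Hessian sketch. -/
theorem ihs_step_basic_inequality
    {n d m : ℕ} (hn : 0 < n) (hm : 0 < m)
    (C : Set (Fin d → ℝ)) (hC : Convex ℝ C)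
    (A : Matrix (Fin n) (Fin d) ℝ) (y : Fin n → ℝ)
    (S : Matrix (Fin m) (Fin n) ℝ)
    (xLS : Fin d → ℝ) (hLSmem : xLS ∈ C)
    (hLSmin : ∀ x ∈ C,
      (1 / (2 * (n : ℝ))) * sqNorm (A.mulVec xLS - y)
        ≤ (1 / (2 * (n : ℝ))) * sqNorm (A.mulVec x - y))
    (xt : Fin d → ℝ)
    (xnext : Fin d → ℝ) (hnextmem : xnext ∈ C)
    (hnextmin : ∀ z ∈ C,
      (1 / (2 * (m : ℝ))) * sqNorm (S.mulVec (A.mulVec (xnext - xt)))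
          - (Aᵀ.mulVec (y - A.mulVec xt)) ⬝ᵥ xnext
        ≤ (1 / (2 * (m : ℝ))) * sqNorm (S.mulVec (A.mulVec (z - xt)))
          - (Aᵀ.mulVec (y - A.mulVec xt)) ⬝ᵥ z) :
    (1 / (m : ℝ)) * sqNorm (S.mulVec (A.mulVec (xnext - xLS))) ≤
      |(A.mulVec (xLS - xt)) ⬝ᵥ
        ((1 - (1 / (m : ℝ)) • (Sᵀ * S)).mulVec (A.mulVec (xnext - xLS)))| := by
  have hn' : (0 : ℝ) < n := by exact_mod_cast hn
  have hm' : (0 : ℝ) < m := by exact_mod_cast hm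
  set Δ := xnext - xLS with hΔ
  set r := y - A.mulVec xt with hr
  -- optimality of `xLS`
  have h1 : 0 ≤ (A.mulVec xLS - y) ⬝ᵥ A.mulVec Δ := by
    refine aux_first_order _ (sqNorm (A.mulVec Δ) / 2) fun t ht ht1 => ?_
    have hx : xLS + t • Δ ∈ C := hC.add_smul_sub_mem hLSmem hnextmem ⟨ht.le, ht1⟩
    have h := le_of_mul_le_mul_left (hLSmin _ hx) (by positivity)
    have e : A.mulVec (xLS + t • Δ) - y = (A.mulVec xLS - y) + t • A.mulVec Δ := by
      rw [mulVec_add, mulVec_smul]; abel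
    rw [e, aux_sqNorm_add] at h
    linarith
  -- optimality of `xnext`
  have h2 : 0 ≤ r ⬝ᵥ A.mulVec Δ
      - (1 / (m : ℝ)) * (S.mulVec (A.mulVec (xnext - xt)) ⬝ᵥ S.mulVec (A.mulVec Δ)) := by
    refine aux_first_order _
      (1 / (2 * (m : ℝ)) * sqNorm (S.mulVec (A.mulVec Δ))) fun t ht ht1 => ?_
    have hx : xnext + t • (xLS - xnext) ∈ C :=
      hC.add_smul_sub_mem hnextmem hLSmem ⟨ht.le, ht1⟩
    have e0 : xnext + t • (xLS - xnext) = xnext + (-t) • Δ := by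
      rw [hΔ, neg_smul, ← smul_neg, neg_sub]
    rw [e0] at hx
    have h := hnextmin _ hx
    have e : S.mulVec (A.mulVec (xnext + (-t) • Δ - xt))
        = S.mulVec (A.mulVec (xnext - xt)) + (-t) • S.mulVec (A.mulVec Δ) := by
      rw [add_sub_right_comm, mulVec_add, mulVec_smul, mulVec_add, mulVec_smul]
    have e2 : (Aᵀ.mulVec r) ⬝ᵥ Δ = r ⬝ᵥ A.mulVec Δ := by
      rw [mulVec_transpose, dotProduct_mulVec]
    rw [e, aux_sqNorm_add, dotProduct_add, dotProduct_smul, e2, smul_eq_mul] at h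
    have e3 : 1 / (m : ℝ) = 2 * (1 / (2 * (m : ℝ))) := by field_simp
    rw [e3]
    linarith
  have e1 : A.mulVec xLS - y = A.mulVec (xLS - xt) - r := by
    rw [hr, mulVec_sub]; abel
  have e2 : xnext - xt = (xLS - xt) + Δ := by rw [hΔ]; abel
  have e3 : sqNorm (S.mulVec (A.mulVec Δ))
      = S.mulVec (A.mulVec Δ) ⬝ᵥ S.mulVec (A.mulVec Δ) := by
    simp only [sqNorm, dotProduct, sq]
  rw [e1, sub_dotProduct] at h1
  rw [e2, mulVec_add, mulVec_add, add_dotProduct, ← e3] at h2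
  refine le_trans ?_ (le_abs_self _)
  have e4 : A.mulVec (xLS - xt) ⬝ᵥ (Sᵀ * S).mulVec (A.mulVec Δ)
      = S.mulVec (A.mulVec (xLS - xt)) ⬝ᵥ S.mulVec (A.mulVec Δ) := by
    rw [← mulVec_mulVec, dotProduct_mulVec, vecMul_transpose]
  rw [sub_mulVec, one_mulVec, smul_mulVec, dotProduct_sub, dotProduct_smul, e4, smul_eq_mul]
  linarith
end

section
/- Let C ⊆ ℝ^d contain x*, let A ∈ ℝ^{n×d}, σ > 0, and let K* = {(t/√n)·A(x − x*) : t ∈ [0,1], x ∈ C}. There is a universal constant c₁ > 0 such that the following holds: for any ε > 0 satisfying the critical inequality σ·W_ε(K*) ≤ ε²·√n, and any measurable map w ↦ x_LS(w) such that for each w ∈ ℝⁿ, x_LS(w) ∈ C minimizes x ↦ ‖(A x* + w) − A x‖₂² over C, one has E_w[(1/n)‖A(x_LS(w) − x*)‖₂²] ≤ c₁·(ε² + σ²/n), where w has i.i.d. N(0,σ²) coordinates. -/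
open MeasureTheory Matrix

/-- Standard Gaussian product measure on ℝⁿ (i.i.d. N(0,1) coordinates). -/
noncomputable def stdGaussPi (n : ℕ) : Measure (Fin n → ℝ) :=
  Measure.pi fun _ => ProbabilityTheory.gaussianReal 0 1

/-- Product Gaussian measure on ℝⁿ with i.i.d. N(0,σ²) coordinates. -/
noncomputable def gaussPi (n : ℕ) (σ : ℝ) : Measure (Fin n → ℝ) :=
  Measure.pi fun _ => ProbabilityTheory.gaussianReal 0 (Real.toNNReal (σ ^ 2))

/-- Localized Gaussian width W_ε(Θ) = E_g sup{|⟨g, θ⟩| : θ ∈ Θ, ‖θ‖₂ ≤ ε}. -/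
noncomputable def gaussWidth {n : ℕ} (ε : ℝ) (Θ : Set (Fin n → ℝ)) : ℝ :=
  ∫ g, sSup ((fun θ => |g ⬝ᵥ θ|) '' {θ ∈ Θ | l2norm θ ≤ ε}) ∂stdGaussPi n

/-- The star-shaped set K* = {(t/√n)·A(x − x*) : t ∈ [0,1], x ∈ C}. -/
def Kstar {n d : ℕ} (A : Matrix (Fin n) (Fin d) ℝ) (C : Set (Fin d → ℝ))
    (xstar : Fin d → ℝ) : Set (Fin n → ℝ) :=
  {v | ∃ t ∈ Set.Icc (0 : ℝ) 1, ∃ x ∈ C, v = (t / Real.sqrt n) • A.mulVec (x - xstar)}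

open ProbabilityTheory

/-- The supremum functional. -/
noncomputable def supFun {n : ℕ} (S : Set (Fin n → ℝ)) (g : Fin n → ℝ) : ℝ :=
  sSup ((fun θ => |g ⬝ᵥ θ|) '' S)

lemma abs_dot_le {n : ℕ} {θ : Fin n → ℝ} {ε : ℝ} (h : ∀ i, |θ i| ≤ ε)
    (g : Fin n → ℝ) : |g ⬝ᵥ θ| ≤ (n * ε) * ‖g‖ := by
  calc |g ⬝ᵥ θ| ≤ ∑ i, |g i * θ i| := Finset.abs_sum_le_sum_abs _ _
    _ ≤ ∑ _i : Fin n, ‖g‖ * ε := by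
        refine Finset.sum_le_sum fun i _ => ?_
        rw [abs_mul]
        exact mul_le_mul (norm_le_pi_norm g i) (h i) (abs_nonneg _) (norm_nonneg _)
    _ = (n * ε) * ‖g‖ := by simp; ring

lemma supFun_bdd {n : ℕ} {S : Set (Fin n → ℝ)} {ε : ℝ} (hS : ∀ θ ∈ S, ∀ i, |θ i| ≤ ε)
    (g : Fin n → ℝ) : BddAbove ((fun θ => |g ⬝ᵥ θ|) '' S) := by
  refine ⟨(n * ε) * ‖g‖, ?_⟩
  rintro _ ⟨θ, hθ, rfl⟩
  exact abs_dot_le (hS θ hθ) g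

lemma le_supFun {n : ℕ} {S : Set (Fin n → ℝ)} {ε : ℝ} (hS : ∀ θ ∈ S, ∀ i, |θ i| ≤ ε)
    (g : Fin n → ℝ) {θ : Fin n → ℝ} (hθ : θ ∈ S) : |g ⬝ᵥ θ| ≤ supFun S g :=
  le_csSup (supFun_bdd hS g) ⟨θ, hθ, rfl⟩

lemma supFun_le_norm {n : ℕ} {S : Set (Fin n → ℝ)} {ε : ℝ} (hne : S.Nonempty) (hS : ∀ θ ∈ S, ∀ i, |θ i| ≤ ε)
    (g : Fin n → ℝ) : supFun S g ≤ (n * ε) * ‖g‖ := by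
  refine csSup_le (hne.image _) ?_
  rintro _ ⟨θ, hθ, rfl⟩
  exact abs_dot_le (hS θ hθ) g

lemma supFun_nonneg {n : ℕ} {S : Set (Fin n → ℝ)} {ε : ℝ} (hne : S.Nonempty) (hS : ∀ θ ∈ S, ∀ i, |θ i| ≤ ε)
    (g : Fin n → ℝ) : 0 ≤ supFun S g := by
  obtain ⟨θ, hθ⟩ := hne
  exact (abs_nonneg _).trans (le_supFun hS g hθ)

lemma supFun_add {n : ℕ} {S : Set (Fin n → ℝ)} {ε : ℝ} (hne : S.Nonempty) (hS : ∀ θ ∈ S, ∀ i, |θ i| ≤ ε)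
    (g h : Fin n → ℝ) : supFun S (g + h) ≤ supFun S g + supFun S h := by
  refine csSup_le (hne.image _) ?_
  rintro _ ⟨θ, hθ, rfl⟩
  simp only [add_dotProduct]
  exact (abs_add_le _ _).trans (add_le_add (le_supFun hS g hθ) (le_supFun hS h hθ))

lemma supFun_smul_le {n : ℕ} {S : Set (Fin n → ℝ)} {ε : ℝ} (hne : S.Nonempty) (hS : ∀ θ ∈ S, ∀ i, |θ i| ≤ ε)
    (c : ℝ) (g : Fin n → ℝ) : supFun S (c • g) ≤ |c| * supFun S g := by
  refine csSup_le (hne.image _) ?_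
  rintro _ ⟨θ, hθ, rfl⟩
  simp only [smul_dotProduct, smul_eq_mul, abs_mul]
  exact mul_le_mul_of_nonneg_left (le_supFun hS g hθ) (abs_nonneg _)

lemma supFun_continuous {n : ℕ} {S : Set (Fin n → ℝ)} {ε : ℝ} (hne : S.Nonempty) (hS : ∀ θ ∈ S, ∀ i, |θ i| ≤ ε)
    : Continuous (supFun S) := by
  have key : ∀ g h : Fin n → ℝ, supFun S g - supFun S h ≤ (n * ε) * ‖g - h‖ := by
    intro g h
    have h1 := supFun_add hne hS (g - h) h
    rw [sub_add_cancel] at h1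
    have h2 := supFun_le_norm hne hS (g - h)
    linarith
  have hL : (n * ε) ≤ |n * ε| := le_abs_self _
  refine (LipschitzWith.of_dist_le_mul (K := ⟨|n * ε|, abs_nonneg _⟩) fun g h => ?_).continuous
  rw [Real.dist_eq, dist_eq_norm, abs_le]
  have h1 := key g h
  have h2 := key h g
  rw [norm_sub_rev] at h2
  have h3 := mul_le_mul_of_nonneg_right hL (norm_nonneg (g - h))
  change -(|n * ε| * ‖g - h‖) ≤ _ ∧ _ ≤ |n * ε| * ‖g - h‖
  constructor <;> linarith

lemma stdGaussPi_eq (n : ℕ) : stdGaussPi n =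
    (stdGaussian (EuclideanSpace ℝ (Fin n))).map
      (EuclideanSpace.equiv (Fin n) ℝ : EuclideanSpace ℝ (Fin n) →L[ℝ] (Fin n → ℝ)) := by
  rw [← map_pi_eq_stdGaussian, Measure.map_map (by fun_prop) (by fun_prop)]
  symm
  exact Measure.map_id

instance isGaussian_stdGaussPi (n : ℕ) : IsGaussian (stdGaussPi n) := by
  rw [stdGaussPi_eq]; infer_instance

lemma stdGaussPi_mean (n : ℕ) : (stdGaussPi n)[id] = 0 := by
  rw [stdGaussPi_eq, integral_map (by fun_prop) (by fun_prop)]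
  simp only [id]
  rw [ContinuousLinearMap.integral_comp_comm _ IsGaussian.integrable_fun_id]
  rw [integral_id_stdGaussian, map_zero]

lemma supFun_memLp {n : ℕ} {S : Set (Fin n → ℝ)} {ε : ℝ} (hne : S.Nonempty)
    (hS : ∀ θ ∈ S, ∀ i, |θ i| ≤ ε) : MemLp (supFun S) 2 (stdGaussPi n) := by
  refine MemLp.of_le_mul (c := n * ε) (IsGaussian.memLp_two_id (μ := stdGaussPi n))
    (supFun_continuous hne hS).aestronglyMeasurable (ae_of_all _ fun g => ?_)
  rw [Real.norm_of_nonneg (supFun_nonneg hne hS g)]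
  exact supFun_le_norm hne hS g

lemma kahane_real {a b u v : ℝ} (c : ℝ) (hc : 0 ≤ c) (hcc : 2 * c ^ 2 = 1)
    (ha : 0 ≤ a) (hb : 0 ≤ b) (hu : 0 ≤ u)
    (h1 : u ≤ c * (a + b)) (h2 : c * u ≤ c * (2 * c * a + v)) (h3 : c * u ≤ c * (2 * c * b + v)) :
    u ^ 2 ≤ 2 * (a * b) + u * v := by
  have hc0 : 0 < c := by
    rcases hc.eq_or_lt with h | h
    · rw [← h] at hcc; norm_num at hcc
    · exact h
  have h2' := le_of_mul_le_mul_left h2 hc0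
  have h3' := le_of_mul_le_mul_left h3 hc0
  rcases le_total a b with hab | hab
  · have e1 : u * u ≤ u * (2 * c * a + v) := mul_le_mul_of_nonneg_left h2' hu
    have e2 : u * (2 * c * a) ≤ c * (a + b) * (2 * c * a) :=
      mul_le_mul_of_nonneg_right h1 (by positivity)
    have e3 : c * (a + b) * (2 * c * a) = (a + b) * a := by
      linear_combination ((a + b) * a) * hcc
    nlinarith [mul_le_mul_of_nonneg_left hab ha]
  · have e1 : u * u ≤ u * (2 * c * b + v) := mul_le_mul_of_nonneg_left h3' hu
    have e2 : u * (2 * c * b) ≤ c * (a + b) * (2 * c * b) :=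
      mul_le_mul_of_nonneg_right h1 (by positivity)
    have e3 : c * (a + b) * (2 * c * b) = (a + b) * b := by
      linear_combination ((a + b) * b) * hcc
    nlinarith [mul_le_mul_of_nonneg_left hab hb]

/-- Second moment of a Gaussian seminorm is at most three times the first moment squared. -/
lemma kahane {n : ℕ} {S : Set (Fin n → ℝ)} {ε : ℝ} (hne : S.Nonempty)
    (hS : ∀ θ ∈ S, ∀ i, |θ i| ≤ ε) :
    ∫ g, supFun S g ^ 2 ∂stdGaussPi n ≤ 3 * (∫ g, supFun S g ∂stdGaussPi n) ^ 2 := by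
  set μ := stdGaussPi n with hμ
  set Z := supFun S with hZ
  have hLp : MemLp Z 2 μ := supFun_memLp hne hS
  have hint : Integrable Z μ := hLp.integrable (by norm_num)
  have hsq : Integrable (fun g => Z g ^ 2) μ := hLp.integrable_sq
  have hcont : Continuous Z := supFun_continuous hne hS
  set R := ContinuousLinearMap.rotation (E := Fin n → ℝ) (Real.pi / 4) with hR
  have hrot : (μ.prod μ).map R = μ.prod μ :=
    IsGaussian.map_rotation_eq_self (stdGaussPi_mean n) _
  have hmp : MeasurePreserving R (μ.prod μ) (μ.prod μ) := ⟨by fun_prop, hrot⟩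
  have hprod : Integrable (fun p : (Fin n → ℝ) × (Fin n → ℝ) => Z p.1 * Z p.2) (μ.prod μ) :=
    hint.mul_prod hint
  have hfst : Integrable (fun p : (Fin n → ℝ) × (Fin n → ℝ) => Z p.1 ^ 2) (μ.prod μ) :=
    hsq.comp_fst μ
  have hprodR : Integrable (fun p => Z (R p).1 * Z (R p).2) (μ.prod μ) :=
    hmp.integrable_comp_of_integrable hprod
  have hfstR : Integrable (fun p => Z (R p).1 ^ 2) (μ.prod μ) :=
    hmp.integrable_comp_of_integrable hfst
  have i1 : ∫ p, Z (R p).1 ^ 2 ∂(μ.prod μ) = ∫ g, Z g ^ 2 ∂μ := by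
    have := integral_map (μ := μ.prod μ) (φ := R) (by fun_prop)
      (f := fun p : (Fin n → ℝ) × (Fin n → ℝ) => Z p.1 ^ 2) (by fun_prop)
    rw [hrot] at this
    rw [← this, integral_fun_fst (fun g => Z g ^ 2)]
    simp
  have i2 : ∫ p : (Fin n → ℝ) × (Fin n → ℝ), Z p.1 * Z p.2 ∂(μ.prod μ) = (∫ g, Z g ∂μ) ^ 2 := by
    rw [integral_prod_mul, sq]
  have i3 : ∫ p, Z (R p).1 * Z (R p).2 ∂(μ.prod μ) = (∫ g, Z g ∂μ) ^ 2 := by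
    have := integral_map (μ := μ.prod μ) (φ := R) (by fun_prop)
      (f := fun p : (Fin n → ℝ) × (Fin n → ℝ) => Z p.1 * Z p.2) (by fun_prop)
    rw [hrot] at this
    rw [← this, i2]
  have hpt : ∀ p : (Fin n → ℝ) × (Fin n → ℝ),
      Z (R p).1 ^ 2 ≤ 2 * (Z p.1 * Z p.2) + Z (R p).1 * Z (R p).2 := by
    rintro ⟨x, y⟩
    set c : ℝ := √2 / 2 with hc
    have hc0 : 0 < c := by positivity
    have hcc : 2 * c ^ 2 = 1 := by
      rw [hc, div_pow, Real.sq_sqrt (by norm_num)]; norm_num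
    have hRe : R (x, y) = (c • x + c • y, -c • x + c • y) := by
      rw [hR, ContinuousLinearMap.rotation_apply, Real.cos_pi_div_four, Real.sin_pi_div_four]
    rw [hRe]
    simp only
    set u := c • x + c • y with hu
    set v := -c • x + c • y with hv
    have hpos := supFun_nonneg hne hS
    have hadd := supFun_add hne hS
    have hsm := supFun_smul_le hne hS
    have a1 : Z u ≤ c * (Z x + Z y) := by
      have e1 := hadd (c • x) (c • y)
      have e2 := hsm c x
      have e3 := hsm c y
      rw [abs_of_pos hc0] at e2 e3
      linarith
    have a2 : Z u ≤ 2 * c * Z x + Z v := by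
      have e0 : u = (2 * c) • x + v := by rw [hu, hv]; module
      have e1 := hadd ((2 * c) • x) v
      have e2 := hsm (2 * c) x
      rw [abs_of_pos (by positivity)] at e2
      rw [← e0] at e1
      linarith
    have a3 : Z u ≤ 2 * c * Z y + Z v := by
      have e0 : u = (2 * c) • y + (-1 : ℝ) • v := by rw [hu, hv]; module
      have e1 := hadd ((2 * c) • y) ((-1 : ℝ) • v)
      have e2 := hsm (2 * c) y
      have e3 := hsm (-1) v
      rw [abs_of_pos (by positivity)] at e2
      rw [← e0] at e1
      simp only [abs_neg, abs_one, one_mul] at e3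
      linarith
    exact kahane_real c hc0.le hcc (hpos x) (hpos y) (hpos u) a1
      (mul_le_mul_of_nonneg_left a2 hc0.le) (mul_le_mul_of_nonneg_left a3 hc0.le)
  have := integral_mono hfstR ((hprod.const_mul 2).add hprodR) hpt
  simp only [Pi.add_apply] at this
  rw [integral_add (hprod.const_mul 2) hprodR, integral_const_mul, i1, i2, i3] at this
  linarith

lemma gaussPi_eq (n : ℕ) (σ : ℝ) :
    gaussPi n σ = (stdGaussPi n).map (fun g => σ • g) := by
  have h := Measure.pi_map_pi (μ := fun _ : Fin n => gaussianReal 0 1)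
    (f := fun _ x => σ * x) (fun _ => by fun_prop)
  have h2 : (gaussianReal 0 1).map (fun x => σ * x) =
      gaussianReal 0 (Real.toNNReal (σ ^ 2)) := by
    rw [gaussianReal_map_const_mul]
    congr 1
    · simp
    · rw [mul_one]; ext; simp [sq_nonneg]
  simp only [h2] at h
  exact h.symm

lemma sqNorm_nonneg {k : ℕ} (v : Fin k → ℝ) : 0 ≤ sqNorm v :=
  Finset.sum_nonneg fun _ _ => sq_nonneg _

lemma sqNorm_smul {k : ℕ} (c : ℝ) (v : Fin k → ℝ) : sqNorm (c • v) = c ^ 2 * sqNorm v := by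
  simp [sqNorm, mul_pow, Finset.mul_sum]

lemma sqNorm_sub {k : ℕ} (w v : Fin k → ℝ) :
    sqNorm (w - v) = sqNorm w - 2 * (w ⬝ᵥ v) + sqNorm v := by
  simp only [sqNorm, dotProduct, Finset.mul_sum, Pi.sub_apply]
  rw [← Finset.sum_sub_distrib, ← Finset.sum_add_distrib]
  exact Finset.sum_congr rfl fun i _ => by ring

lemma abs_le_l2norm {k : ℕ} (v : Fin k → ℝ) (i : Fin k) : |v i| ≤ l2norm v := by
  rw [l2norm, ← Real.sqrt_sq_eq_abs]
  exact Real.sqrt_le_sqrt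
    (Finset.single_le_sum (f := fun i => v i ^ 2) (fun _ _ => sq_nonneg _) (Finset.mem_univ i))

/-- upper bound on the mean-squared error of constrained least
squares (Proposition 2). -/
theorem constrained_ls_mse_upper_bound :
    ∃ c₁ : ℝ, 0 < c₁ ∧
      ∀ (n d : ℕ), 0 < n →
      ∀ (C : Set (Fin d → ℝ)) (xstar : Fin d → ℝ), xstar ∈ C →
      ∀ (A : Matrix (Fin n) (Fin d) ℝ) (σ : ℝ), 0 < σ →
      ∀ ε : ℝ, 0 < ε →
        σ * gaussWidth ε (Kstar A C xstar) ≤ ε ^ 2 * Real.sqrt n →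
      ∀ xLS : (Fin n → ℝ) → (Fin d → ℝ), Measurable xLS →
        (∀ w : Fin n → ℝ, xLS w ∈ C ∧ ∀ x ∈ C,
          sqNorm ((A.mulVec xstar + w) - A.mulVec (xLS w))
            ≤ sqNorm ((A.mulVec xstar + w) - A.mulVec x)) →
        ∫ w, (1 / (n : ℝ)) * sqNorm (A.mulVec (xLS w - xstar)) ∂gaussPi n σ
          ≤ c₁ * (ε ^ 2 + σ ^ 2 / n) := by
  refine ⟨13, by norm_num, ?_⟩
  intro n d hn C xstar hx A σ hσ ε hε hcrit xLS _ hLS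
  have hn' : (0 : ℝ) < n := by exact_mod_cast hn
  set S : Set (Fin n → ℝ) := {θ ∈ Kstar A C xstar | l2norm θ ≤ ε} with hSdef
  have hS : ∀ θ ∈ S, ∀ i, |θ i| ≤ ε := fun θ hθ i => (abs_le_l2norm θ i).trans hθ.2
  have hne : S.Nonempty := by
    refine ⟨0, ⟨0, by simp, xstar, hx, by simp⟩, ?_⟩
    simp [l2norm, sqNorm, hε.le]
  have hW : gaussWidth ε (Kstar A C xstar) = ∫ g, supFun S g ∂stdGaussPi n := rfl
  rw [hW] at hcrit
  set W := ∫ g, supFun S g ∂stdGaussPi n with hWdef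
  have hW0 : 0 ≤ W := integral_nonneg (supFun_nonneg hne hS)
  have hpt : ∀ w, (1 / (n : ℝ)) * sqNorm (A.mulVec (xLS w - xstar)) ≤
      ε ^ 2 + 4 / (n * ε ^ 2) * supFun S w ^ 2 := by
    intro w
    obtain ⟨hC, hmin⟩ := hLS w
    set v := A.mulVec (xLS w - xstar) with hv
    set N := sqNorm v with hN
    have hN0 : 0 ≤ N := sqNorm_nonneg v
    have hbasic : N ≤ 2 * (w ⬝ᵥ v) := by
      have h := hmin xstar hx
      have e1 : A.mulVec xstar + w - A.mulVec (xLS w) = w - v := by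
        rw [hv, mulVec_sub]; abel
      have e2 : A.mulVec xstar + w - A.mulVec xstar = w := by abel
      rw [e1, e2, sqNorm_sub] at h
      linarith
    set r := √(N / n) with hr
    have hr2 : r ^ 2 = N / n := Real.sq_sqrt (by positivity)
    have hr0 : 0 ≤ r := Real.sqrt_nonneg _
    have hZ0 : 0 ≤ 4 / (n * ε ^ 2) * supFun S w ^ 2 := by positivity
    rw [one_div, inv_mul_eq_div, ← hr2]
    rcases le_or_gt r ε with hle | hlt
    · have := pow_le_pow_left₀ hr0 hle 2
      linarith
    · have hrpos : 0 < r := hε.trans hlt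
      have hs : 0 < √(n : ℝ) := Real.sqrt_pos.2 hn'
      have hs2 : √(n : ℝ) ^ 2 = n := Real.sq_sqrt hn'.le
      have hmem : (ε / r / √(n : ℝ)) • v ∈ S := by
        refine ⟨⟨ε / r, ⟨by positivity, (div_le_one hrpos).2 hlt.le⟩, xLS w, hC, rfl⟩, ?_⟩
        rw [l2norm, sqNorm_smul]
        have : (ε / r / √(n : ℝ)) ^ 2 * sqNorm v = ε ^ 2 := by
          have hNr : sqNorm v = r ^ 2 * n := by rw [hr2]; field_simp; rfl
          rw [hNr, div_pow, div_pow, hs2]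
          field_simp
        rw [this, Real.sqrt_sq hε.le]
      have h1 := (le_abs_self _).trans (le_supFun hS w hmem)
      rw [dotProduct_smul, smul_eq_mul] at h1
      set Z := supFun S w with hZ
      have h2 : w ⬝ᵥ v ≤ Z * (√(n : ℝ) * r / ε) := by
        have := mul_le_mul_of_nonneg_right h1 (by positivity : 0 ≤ √(n : ℝ) * r / ε)
        refine le_trans (le_of_eq ?_) this
        field_simp
      have hNr : N = r ^ 2 * n := by rw [hr2]; field_simp
      have h3 : r * (√(n : ℝ) * ε) ≤ 2 * Z := by
        have e : r * √(n : ℝ) * (r * √(n : ℝ)) ≤ r * √(n : ℝ) * (2 * Z / ε) := by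
          calc r * √(n : ℝ) * (r * √(n : ℝ)) = N := by linear_combination (r ^ 2) * hs2 - hNr
            _ ≤ 2 * (Z * (√(n : ℝ) * r / ε)) := by linarith
            _ = _ := by ring
        have e' := le_of_mul_le_mul_left e (by positivity)
        rw [le_div_iff₀ hε] at e'
        linarith
      have h4 := pow_le_pow_left₀ (by positivity) h3 2
      rw [mul_pow, mul_pow, hs2] at h4
      have h5 : r ^ 2 ≤ 4 / (n * ε ^ 2) * Z ^ 2 := by
        rw [div_mul_eq_mul_div, le_div_iff₀ (by positivity)]
        linarith
      have := sq_nonneg ε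
      linarith
  have hcont := supFun_continuous hne hS
  have hsqint : Integrable (fun g => supFun S g ^ 2) (stdGaussPi n) :=
    (supFun_memLp hne hS).integrable_sq
  rw [gaussPi_eq]
  have hscale : ∀ g, supFun S (σ • g) ≤ σ * supFun S g := fun g => by
    have := supFun_smul_le hne hS σ g
    rwa [abs_of_pos hσ] at this
  -- pass to the standard Gaussian
  have hbound : ∀ g, ε ^ 2 + 4 / (n * ε ^ 2) * supFun S (σ • g) ^ 2 ≤
      ε ^ 2 + 4 / (n * ε ^ 2) * σ ^ 2 * supFun S g ^ 2 := by
    intro g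
    have := pow_le_pow_left₀ (supFun_nonneg hne hS _) (hscale g) 2
    rw [mul_pow] at this
    have := mul_le_mul_of_nonneg_left this (by positivity : 0 ≤ 4 / (n * ε ^ 2))
    linarith
  have hGint : Integrable (fun g => ε ^ 2 + 4 / (n * ε ^ 2) * σ ^ 2 * supFun S g ^ 2)
      (stdGaussPi n) := (integrable_const _).add (hsqint.const_mul _)
  have hmsm : Measurable (fun g : Fin n → ℝ => σ • g) := by fun_prop
  have hemb : MeasurableEmbedding (fun g : Fin n → ℝ => σ • g) :=
    measurableEmbedding_const_smul₀ hσ.ne'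
  rw [hemb.integral_map]
  have hfinal := integral_mono_of_nonneg (μ := stdGaussPi n)
    (f := fun g => (1 / (n : ℝ)) * sqNorm (A.mulVec (xLS (σ • g) - xstar)))
    (ae_of_all _ fun g => mul_nonneg (by positivity) (sqNorm_nonneg _)) hGint
    (ae_of_all _ fun g => (hpt _).trans (hbound g))
  refine hfinal.trans ?_
  rw [integral_add (integrable_const _) (hsqint.const_mul _), integral_const_mul]
  simp only [integral_const, probReal_univ, one_smul]
  have hk := kahane hne hS
  rw [← hWdef] at hk
  have hs2 : √(n : ℝ) ^ 2 = n := Real.sq_sqrt hn'.le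
  have hc2 := pow_le_pow_left₀ (by positivity) hcrit 2
  rw [mul_pow, mul_pow, hs2] at hc2
  have h6 : 4 / (n * ε ^ 2) * σ ^ 2 * ∫ g, supFun S g ^ 2 ∂stdGaussPi n ≤ 12 * ε ^ 2 := by
    calc _ ≤ 4 / (n * ε ^ 2) * σ ^ 2 * (3 * W ^ 2) :=
          mul_le_mul_of_nonneg_left hk (by positivity)
      _ = 12 / (n * ε ^ 2) * (σ ^ 2 * W ^ 2) := by ring
      _ ≤ 12 / (n * ε ^ 2) * ((ε ^ 2) ^ 2 * n) := mul_le_mul_of_nonneg_left hc2 (by positivity)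
      _ = 12 * ε ^ 2 := by field_simp
  have h7 : 0 ≤ σ ^ 2 / n := by positivity
  linarith
end
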